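/- Let ω ∈ ℝ with ω ≠ 0. Suppose R₁, R₂ : (r₋, r₊) → ℂ solve the radial o.d.e. with frequency ω, and there exist δ > 0 and C¹ functions Ĥ₁ : (r₊ − δ, r₊] → ℂ and Ĥ₂ : [r₋, r₋ + δ) → ℂ with Ĥ₁(r₊) = Ĥ₂(r₋) = 1, such that R₁(r) = (r₊ − r)^(−iω/(2κ₊))·Ĥ₁(r) for r ∈ (r₊ − δ, r₊) and R₂(r) = (r − r₋)^(−iω/(2κ₋))·Ĥ₂(r) for r ∈ (r₋, r₋ + δ). Then R₁ and R₂ are linearly independent over ℂ. -/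

import Mathlib

noncomputable section

/-- The metric coefficient `μ(r) = 1 - 2M/r + e²/r² - (Λ/3)r²`. -/
def mu (M e Λ : ℝ) (r : ℝ) : ℝ := 1 - 2*M/r + e^2/r^2 - (Λ/3)*r^2

/-- Surface gravity of the event horizon: `κ₊ = (1/2)·μ′(r₊)`. -/
def kappaP (M e Λ rp : ℝ) : ℝ := (1/2) * deriv (mu M e Λ) rp

/-- Surface gravity of the Cauchy horizon: `κ₋ = -(1/2)·μ′(r₋)`. -/
def kappaM (M e Λ rm : ℝ) : ℝ := -(1/2) * deriv (mu M e Λ) rm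

/-- Surface gravity of the cosmological horizon: `κ_c = -(1/2)·μ′(r_c)`. -/
def kappaC (M e Λ rc : ℝ) : ℝ := -(1/2) * deriv (mu M e Λ) rc

/-- A twice-differentiable `R : I → ℂ` solves the radial o.d.e. with frequency `ω`:
`r⁻²·μ(r)·(d/dr)(r²·μ(r)·R′(r)) + ω²·R(r) = 0` for all `r ∈ I`. -/
def SolvesODE (M e Λ : ℝ) (ω : ℂ) (I : Set ℝ) (R : ℝ → ℂ) : Prop :=
  (∀ r ∈ I, DifferentiableAt ℝ R r) ∧
  (∀ r ∈ I, DifferentiableAt ℝ (deriv R) r) ∧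
  ∀ r ∈ I, ((r:ℂ)^2)⁻¹ * (mu M e Λ r : ℂ) *
      deriv (fun s : ℝ => (s:ℂ)^2 * (mu M e Λ s : ℂ) * deriv R s) r
    + ω^2 * R r = 0

/-- The set `𝒰` of `ω ∈ ℂ` not of the form `i·κ·n` with `κ ∈ {κ₊, κ₋, κ_c}` and
`n` a nonzero integer. -/
def calU (kp km kc : ℝ) : Set ℂ :=
  {ω : ℂ | ∀ κ ∈ ({kp, km, kc} : Set ℝ), ∀ n : ℤ, n ≠ 0 → ω ≠ Complex.I * κ * n}

/-- The conserved flux of a solution `R`: up to a factor `2i`, the Wronskian of `R` with its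
complex conjugate, weighted by `r²μ`. -/
def radialFlux (M e Λ : ℝ) (R : ℝ → ℂ) (r : ℝ) : ℝ :=
  r ^ 2 * mu M e Λ r * (deriv R r * star (R r)).im

lemma hasDerivAt_mu (M e Λ : ℝ) {r : ℝ} (hr : r ≠ 0) :
    HasDerivAt (mu M e Λ) (2 * M / r ^ 2 - 2 * e ^ 2 / r ^ 3 - 2 * Λ / 3 * r) r := by
  have h1 := (hasDerivAt_inv hr).const_mul (2 * M)
  have h2 := ((hasDerivAt_pow 2 r).inv (pow_ne_zero 2 hr)).const_mul (e ^ 2)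
  have h3 := (hasDerivAt_pow 2 r).const_mul (Λ / 3)
  have h := ((h1.const_sub 1).add h2).sub h3
  have hf : mu M e Λ = fun x => 1 - 2 * M * x⁻¹ + e ^ 2 * (x ^ 2)⁻¹ - Λ / 3 * x ^ 2 := by
    funext x
    simp only [mu, div_eq_mul_inv]
  rw [hf]
  refine h.congr_deriv ?_
  field_simp
  ring

lemma sq_mul_mu (M e Λ : ℝ) {r : ℝ} (hr : r ≠ 0) :
    r ^ 2 * mu M e Λ r = r ^ 2 - 2 * M * r + e ^ 2 - Λ / 3 * r ^ 4 := by
  unfold mu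
  field_simp

/-- The quartic `r²μ` factors over the three positive zeros of `μ` and the remaining zero
`-(r₋ + r₊ + r_c)`. -/
lemma sq_mul_mu_eq_prod {M e Λ rm rp rc : ℝ} (h₀ : 0 < rm) (h₁ : rm < rp) (h₂ : rp < rc)
    (hzm : mu M e Λ rm = 0) (hzp : mu M e Λ rp = 0) (hzc : mu M e Λ rc = 0)
    {r : ℝ} (hr : r ≠ 0) :
    r ^ 2 * mu M e Λ r = -(Λ / 3) * ((r - rm) * (r - rp) * (r - rc) * (r + rm + rp + rc)) := by
  have em := sq_mul_mu M e Λ h₀.ne'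
  have ep := sq_mul_mu M e Λ (h₀.trans h₁).ne'
  have ec := sq_mul_mu M e Λ (h₀.trans (h₁.trans h₂)).ne'
  rw [hzm, mul_zero] at em
  rw [hzp, mul_zero] at ep
  rw [hzc, mul_zero] at ec
  have d1 : rm + rp - 2 * M - Λ / 3 * ((rm + rp) * (rm ^ 2 + rp ^ 2)) = 0 := by
    apply mul_left_cancel₀ (sub_pos.2 h₁).ne'
    linear_combination em - ep
  have d2 : rp + rc - 2 * M - Λ / 3 * ((rp + rc) * (rp ^ 2 + rc ^ 2)) = 0 := by
    apply mul_left_cancel₀ (sub_pos.2 h₂).ne'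
    linear_combination ep - ec
  have d3 : 1 - Λ / 3 * (rm ^ 2 + rp ^ 2 + rc ^ 2 + rm * rp + rm * rc + rp * rc) = 0 := by
    apply mul_left_cancel₀ (sub_pos.2 (h₁.trans h₂)).ne'
    linear_combination d2 - d1
  rw [sq_mul_mu M e Λ hr]
  linear_combination -em + (r - rm) * d1 + (r - rm) * (r - rp) * d3

lemma mu_neg_of_mem_Ioo {M e Λ rm rp rc : ℝ} (hΛ : 0 < Λ) (h₀ : 0 < rm) (h₁ : rm < rp)
    (h₂ : rp < rc) (hzm : mu M e Λ rm = 0) (hzp : mu M e Λ rp = 0) (hzc : mu M e Λ rc = 0)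
    {r : ℝ} (hr : r ∈ Set.Ioo rm rp) : mu M e Λ r < 0 := by
  have hr0 : 0 < r := h₀.trans hr.1
  have h := sq_mul_mu_eq_prod h₀ h₁ h₂ hzm hzp hzc hr0.ne'
  have h3 : 0 < (r - rm) * (rp - r) * (rc - r) * (r + rm + rp + rc) := by
    have := sub_pos.2 hr.1
    have := sub_pos.2 hr.2
    have := sub_pos.2 (hr.2.trans h₂)
    have : 0 < r + rm + rp + rc := by linarith
    positivity
  have h4 : r ^ 2 * mu M e Λ r < 0 := by
    rw [h]
    nlinarith [mul_pos hΛ h3]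
  exact neg_of_mul_neg_right h4 (sq_nonneg r)

/-- The derivative of `μ` at a zero, read off from a factorization of `r²μ`. -/
lemma sq_mul_deriv_mu_of_eq_mul {M e Λ x : ℝ} (hx : x ≠ 0) {g : ℝ → ℝ} (hg : ContinuousAt g x)
    (h : ∀ r, r ≠ 0 → r ^ 2 * mu M e Λ r = (r - x) * g r) :
    x ^ 2 * deriv (mu M e Λ) x = g x := by
  have hz : mu M e Λ x = 0 := by simpa [hx] using h x hx
  have h1 : HasDerivAt (fun r => r ^ 2 * mu M e Λ r) (x ^ 2 * deriv (mu M e Λ) x) x := by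
    have := (hasDerivAt_pow 2 x).mul (hasDerivAt_mu M e Λ hx).differentiableAt.hasDerivAt
    rw [hz, mul_zero, zero_add] at this
    exact this
  have h2 : HasDerivAt (fun r => r ^ 2 * mu M e Λ r) (g x) x := by
    rw [hasDerivAt_iff_tendsto_slope]
    refine (hg.tendsto.mono_left nhdsWithin_le_nhds).congr' ?_
    filter_upwards [self_mem_nhdsWithin, nhdsWithin_le_nhds (isOpen_ne.mem_nhds hx)] with r hr hr0
    rw [slope_def_field, h r hr0, h x hx, sub_self, zero_mul, sub_zero,
      mul_div_cancel_left₀ _ (sub_ne_zero.2 hr)]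
  exact h1.unique h2

lemma deriv_mu_rp_ne_zero {M e Λ rm rp rc : ℝ} (hΛ : 0 < Λ) (h₀ : 0 < rm) (h₁ : rm < rp)
    (h₂ : rp < rc) (hzm : mu M e Λ rm = 0) (hzp : mu M e Λ rp = 0) (hzc : mu M e Λ rc = 0) :
    deriv (mu M e Λ) rp ≠ 0 := by
  have h := sq_mul_deriv_mu_of_eq_mul (M := M) (e := e) (Λ := Λ) (x := rp) (h₀.trans h₁).ne'
    (g := fun r => -(Λ / 3) * ((r - rm) * (r - rc) * (r + rm + rp + rc))) (by fun_prop)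
    (fun r hr => by rw [sq_mul_mu_eq_prod h₀ h₁ h₂ hzm hzp hzc hr]; ring)
  intro h0
  rw [h0, mul_zero] at h
  have : -(Λ / 3) * ((rp - rm) * (rp - rc) * (rp + rm + rp + rc)) ≠ 0 := by
    simp only [ne_eq, mul_eq_zero, neg_eq_zero, div_eq_zero_iff, not_or]
    exact ⟨⟨hΛ.ne', by norm_num⟩, ⟨by linarith, by linarith⟩, by linarith⟩
  exact this h.symm

lemma deriv_mu_rm_ne_zero {M e Λ rm rp rc : ℝ} (hΛ : 0 < Λ) (h₀ : 0 < rm) (h₁ : rm < rp)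
    (h₂ : rp < rc) (hzm : mu M e Λ rm = 0) (hzp : mu M e Λ rp = 0) (hzc : mu M e Λ rc = 0) :
    deriv (mu M e Λ) rm ≠ 0 := by
  have h := sq_mul_deriv_mu_of_eq_mul (M := M) (e := e) (Λ := Λ) (x := rm) h₀.ne'
    (g := fun r => -(Λ / 3) * ((r - rp) * (r - rc) * (r + rm + rp + rc))) (by fun_prop)
    (fun r hr => by rw [sq_mul_mu_eq_prod h₀ h₁ h₂ hzm hzp hzc hr]; ring)
  intro h0
  rw [h0, mul_zero] at h
  have : -(Λ / 3) * ((rm - rp) * (rm - rc) * (rm + rm + rp + rc)) ≠ 0 := by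
    simp only [ne_eq, mul_eq_zero, neg_eq_zero, div_eq_zero_iff, not_or]
    exact ⟨⟨hΛ.ne', by norm_num⟩, ⟨by linarith, by linarith⟩, by linarith⟩
  exact this h.symm

/-- For real frequencies the flux of a solution is locally constant. -/
lemma SolvesODE.hasDerivAt_radialFlux {M e Λ ω : ℝ} {I : Set ℝ} {R : ℝ → ℂ}
    (h : SolvesODE M e Λ ω I R) {r : ℝ} (hr : r ∈ I) (hr0 : r ≠ 0) (hμ : mu M e Λ r ≠ 0) :
    HasDerivAt (radialFlux M e Λ R) 0 r := by
  obtain ⟨hR, hR', hode⟩ := h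
  set G : ℝ → ℂ := fun s => (s : ℂ) ^ 2 * (mu M e Λ s : ℂ) * deriv R s with hG
  have hflux : radialFlux M e Λ R = fun s => (G s * star (R s)).im := by
    funext s
    have : G s * star (R s) = ((s ^ 2 * mu M e Λ s : ℝ) : ℂ) * (deriv R s * star (R s)) := by
      simp only [hG]
      push_cast
      ring
    rw [this, Complex.im_ofReal_mul, radialFlux]
  have hGd : DifferentiableAt ℝ G r := by
    have h1 : DifferentiableAt ℝ (fun s : ℝ => (mu M e Λ s : ℂ)) r :=
      (hasDerivAt_mu M e Λ hr0).ofReal_comp.differentiableAt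
    have h2 : DifferentiableAt ℝ (fun s : ℝ => (s : ℂ)) r :=
      (hasDerivAt_id r).ofReal_comp.differentiableAt
    exact ((h2.pow 2).mul h1).mul (hR' r hr)
  have hG' : deriv G r = ((-(ω ^ 2 * r ^ 2 / mu M e Λ r) : ℝ) : ℂ) * R r := by
    have h1 := hode r hr
    have h2 : (r : ℂ) ≠ 0 := by exact_mod_cast hr0
    have h3 : (mu M e Λ r : ℂ) ≠ 0 := by exact_mod_cast hμ
    push_cast
    field_simp at h1 ⊢
    linear_combination h1
  have hd := hGd.hasDerivAt.mul (hR r hr).hasDerivAt.star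
  have him := Complex.imCLM.hasFDerivAt.comp_hasDerivAt r hd
  rw [hflux]
  refine him.congr_deriv ?_
  have key : deriv G r * star (R r) + G r * star (deriv R r) =
      ((-(ω ^ 2 * r ^ 2 / mu M e Λ r) * Complex.normSq (R r) +
        r ^ 2 * mu M e Λ r * Complex.normSq (deriv R r) : ℝ) : ℂ) := by
    rw [hG']
    simp only [hG, Complex.star_def]
    push_cast
    rw [← Complex.mul_conj, ← Complex.mul_conj]
    ring
  rw [key, Complex.imCLM_apply, Complex.ofReal_im]

lemma SolvesODE.radialFlux_eq {M e Λ ω a b : ℝ} {R : ℝ → ℂ}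
    (h : SolvesODE M e Λ ω (Set.Ioo a b) R) (ha : 0 < a)
    (hμ : ∀ r ∈ Set.Ioo a b, mu M e Λ r ≠ 0) {x y : ℝ} (hx : x ∈ Set.Ioo a b)
    (hy : y ∈ Set.Ioo a b) : radialFlux M e Λ R x = radialFlux M e Λ R y := by
  have hd : ∀ r ∈ Set.Ioo a b, HasDerivAt (radialFlux M e Λ R) 0 r := fun r hr =>
    h.hasDerivAt_radialFlux hr (ha.trans hr.1).ne' (hμ r hr)
  exact isOpen_Ioo.is_const_of_deriv_eq_zero isPreconnected_Ioo
    (fun r hr => (hd r hr).differentiableAt.differentiableWithinAt)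
    (fun r hr => (hd r hr).deriv) hx hy

/-- The weighted current of `(σ(r - x₀))^z H` for purely imaginary `z`. -/
lemma sub_mul_im_deriv_cpow_mul {R H : ℝ → ℂ} {z : ℂ} (hz : z.re = 0) {σ x₀ r : ℝ}
    (hr : 0 < σ * (r - x₀)) (hH : DifferentiableAt ℝ H r)
    (hR : R =ᶠ[nhds r] fun s => ((σ * (s - x₀) : ℝ) : ℂ) ^ z * H s) :
    (r - x₀) * (deriv R r * star (R r)).im =
      z.im * Complex.normSq (H r) + (r - x₀) * (deriv H r * star (H r)).im := by
  have hσ : (σ : ℂ) ≠ 0 := by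
    rintro h
    have : σ = 0 := by exact_mod_cast h
    simp [this] at hr
  have hrx : ((r : ℂ) - x₀) ≠ 0 := by
    intro h
    have : r - x₀ = 0 := by exact_mod_cast h
    simp [this] at hr
  set t : ℂ := (σ : ℂ) * ((r : ℂ) - x₀) with ht
  have htr : t = ((σ * (r - x₀) : ℝ) : ℂ) := by rw [ht]; push_cast; ring
  have ht0 : t ≠ 0 := mul_ne_zero hσ hrx
  have hpow : HasDerivAt (fun s : ℝ => ((σ * (s - x₀) : ℝ) : ℂ) ^ z) (t ^ z * (z / (r - x₀))) r := by
    have h1 : HasDerivAt (fun w : ℂ => (σ : ℂ) * (w - x₀)) (σ * 1) (r : ℂ) :=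
      ((hasDerivAt_id _).sub_const _).const_mul _
    have h2 := (h1.cpow_const (c := z) (by
      change t ∈ _
      rw [htr, Complex.ofReal_mem_slitPlane]
      exact hr)).comp_ofReal
    push_cast
    refine h2.congr_deriv ?_
    change z * t ^ (z - 1) * (σ * 1) = _
    rw [Complex.cpow_sub _ _ ht0, Complex.cpow_one, ht]
    field_simp
  have hd := hpow.mul hH.hasDerivAt
  have hnorm : t ^ z * star (t ^ z) = 1 := by
    rw [Complex.star_def, Complex.mul_conj, Complex.normSq_eq_norm_sq, htr,
      Complex.norm_cpow_eq_rpow_re_of_pos hr, hz]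
    simp
  have hder := hR.deriv_eq.trans hd.deriv
  have hval : R r = t ^ z * H r := by rw [hR.eq_of_nhds, htr]
  have hval' : deriv R r = t ^ z * (z / (r - x₀)) * H r + t ^ z * deriv H r := by
    rw [hder, htr]
  have key : ((r - x₀ : ℝ) : ℂ) * (deriv R r * star (R r)) =
      z * (Complex.normSq (H r) : ℂ) + ((r - x₀ : ℝ) : ℂ) * (deriv H r * star (H r)) := by
    rw [hval, hval', star_mul, ← Complex.mul_conj, ← Complex.star_def]
    push_cast
    have : ((r : ℂ) - x₀) * ((t ^ z * (z / (r - x₀)) * H r + t ^ z * deriv H r) *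
        (star (H r) * star (t ^ z))) = (t ^ z * star (t ^ z)) *
        (z * (H r * star (H r)) + ((r : ℂ) - x₀) * (deriv H r * star (H r))) := by
      field_simp
    rw [this, hnorm, one_mul]
  have him := congrArg Complex.im key
  rwa [Complex.im_ofReal_mul, Complex.add_im, Complex.im_ofReal_mul, Complex.im_mul_ofReal] at him

/-- The limit of the flux at a zero of `μ` near which the solution oscillates like
`|r - x₀|^z` with purely imaginary `z`. -/
lemma tendsto_radialFlux {M e Λ : ℝ} {R H : ℝ → ℂ} {z : ℂ} (hz : z.re = 0) {σ x₀ : ℝ}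
    (hx₀ : x₀ ≠ 0) (hμ : mu M e Λ x₀ = 0) {s : Set ℝ} (hs : UniqueDiffOn ℝ s) (hxs : x₀ ∈ s)
    (hH : ContDiffOn ℝ 1 H s) (hH1 : H x₀ = 1) {l : Filter ℝ} (hl : l ≤ nhdsWithin x₀ s)
    (hls : ∀ᶠ r in l, s ∈ nhds r) (hσ : ∀ᶠ r in l, 0 < σ * (r - x₀))
    (hR : ∀ᶠ r in l, R =ᶠ[nhds r] fun s => ((σ * (s - x₀) : ℝ) : ℂ) ^ z * H s) :
    Filter.Tendsto (radialFlux M e Λ R) l (nhds (x₀ ^ 2 * deriv (mu M e Λ) x₀ * z.im)) := by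
  have hl' : l ≤ nhds x₀ := hl.trans nhdsWithin_le_nhds
  have hlne : l ≤ nhdsWithin x₀ {x₀}ᶜ := by
    refine le_inf hl' (Filter.le_principal_iff.2 ?_)
    filter_upwards [hσ] with r hr hrx
    rw [Set.mem_singleton_iff.1 hrx] at hr
    simp at hr
  have hslope : Filter.Tendsto (fun r => r ^ 2 * (mu M e Λ r / (r - x₀))) l
      (nhds (x₀ ^ 2 * deriv (mu M e Λ) x₀)) := by
    have h1 := (hasDerivAt_iff_tendsto_slope.1
      (hasDerivAt_mu M e Λ hx₀).differentiableAt.hasDerivAt).mono_left hlne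
    have h2 : Filter.Tendsto (fun r : ℝ => r ^ 2) l (nhds (x₀ ^ 2)) :=
      ((continuous_pow 2).tendsto x₀).mono_left hl'
    refine (h2.mul h1).congr fun r => ?_
    rw [slope_def_field, hμ, sub_zero]
  have hHlim : Filter.Tendsto H l (nhds 1) := by
    have := (hH.continuousOn x₀ hxs).tendsto.mono_left hl
    rwa [hH1] at this
  have hH'lim : Filter.Tendsto (deriv H) l (nhds (derivWithin H s x₀)) := by
    refine (((hH.continuousOn_derivWithin hs le_rfl) x₀ hxs).tendsto.mono_left hl).congr' ?_
    filter_upwards [hls] with r hr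
    exact derivWithin_of_mem_nhds hr
  have hsub : Filter.Tendsto (fun r : ℝ => r - x₀) l (nhds 0) := by
    have : Filter.Tendsto (fun r : ℝ => r - x₀) l (nhds (x₀ - x₀)) :=
      ((continuous_sub_right x₀).tendsto x₀).mono_left hl'
    rwa [sub_self] at this
  have hcur : Filter.Tendsto (fun r => z.im * Complex.normSq (H r) +
      (r - x₀) * (deriv H r * star (H r)).im) l (nhds z.im) := by
    have h1 := ((Complex.continuous_normSq.tendsto 1).comp hHlim).const_mul z.im
    have h2 := hsub.mul ((Complex.continuous_im.tendsto _).comp (hH'lim.mul hHlim.star))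
    have h3 := h1.add h2
    simp only [map_one, mul_one, zero_mul, add_zero] at h3
    exact h3
  refine (hslope.mul hcur).congr' ?_
  filter_upwards [hls, hσ, hR] with r hr hσr hRr
  have hne : r - x₀ ≠ 0 := fun h => by simp [h] at hσr
  rw [← sub_mul_im_deriv_cpow_mul hz hσr
    ((hH.differentiableOn one_ne_zero).differentiableAt hr) hRr, radialFlux]
  field_simp

lemma radialFlux_const_mul {M e Λ : ℝ} {R : ℝ → ℂ} (a : ℂ) (r : ℝ) :
    radialFlux M e Λ (fun s => a * R s) r = Complex.normSq a * radialFlux M e Λ R r := by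
  have h : a * deriv R r * star (a * R r) =
      (Complex.normSq a : ℂ) * (deriv R r * star (R r)) := by
    rw [star_mul, ← Complex.mul_conj, Complex.star_def]
    ring
  rw [radialFlux, radialFlux, deriv_const_mul_field, h, Complex.im_ofReal_mul]
  ring

/-- Two real-frequency solutions in the black hole interior, one ingoing at `r₊` and
one ingoing at `r₋`, are linearly independent over `ℂ`. -/
theorem interior_linear_independence (M e Λ rm rp rc : ℝ)
    (hM : 0 < M) (he : 0 < e) (hΛ : 0 < Λ)
    (h₀ : 0 < rm) (h₁ : rm < rp) (h₂ : rp < rc)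
    (hzm : mu M e Λ rm = 0) (hzp : mu M e Λ rp = 0) (hzc : mu M e Λ rc = 0)
    (ω : ℝ) (hω : ω ≠ 0)
    (R₁ R₂ : ℝ → ℂ)
    (hR₁ : SolvesODE M e Λ (ω : ℂ) (Set.Ioo rm rp) R₁)
    (hR₂ : SolvesODE M e Λ (ω : ℂ) (Set.Ioo rm rp) R₂)
    (δ : ℝ) (hδ : 0 < δ)
    (H₁ : ℝ → ℂ) (hH₁ : ContDiffOn ℝ 1 H₁ (Set.Ioc (rp - δ) rp)) (hH₁1 : H₁ rp = 1)
    (H₂ : ℝ → ℂ) (hH₂ : ContDiffOn ℝ 1 H₂ (Set.Ico rm (rm + δ))) (hH₂1 : H₂ rm = 1)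
    (hform₁ : ∀ r ∈ Set.Ioo (rp - δ) rp ∩ Set.Ioo rm rp,
      R₁ r = ((rp - r : ℝ) : ℂ) ^ (-(Complex.I * ω) / (2 * (kappaP M e Λ rp : ℂ))) * H₁ r)
    (hform₂ : ∀ r ∈ Set.Ioo rm (rm + δ) ∩ Set.Ioo rm rp,
      R₂ r = ((r - rm : ℝ) : ℂ) ^ (-(Complex.I * ω) / (2 * (kappaM M e Λ rm : ℂ))) * H₂ r) :
    ∀ a b : ℂ, (∀ r ∈ Set.Ioo rm rp, a * R₁ r + b * R₂ r = 0) → a = 0 ∧ b = 0 := by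
  intro a b hab
  have h₀p := h₀.trans h₁
  have hμ : ∀ r ∈ Set.Ioo rm rp, mu M e Λ r ≠ 0 := fun r hr =>
    (mu_neg_of_mem_Ioo hΛ h₀ h₁ h₂ hzm hzp hzc hr).ne
  have hdp := deriv_mu_rp_ne_zero hΛ h₀ h₁ h₂ hzm hzp hzc
  have hdm := deriv_mu_rm_ne_zero hΛ h₀ h₁ h₂ hzm hzp hzc
  have hexp : ∀ κ : ℝ, -(Complex.I * ω) / (2 * (κ : ℂ)) = ((-ω / (2 * κ) : ℝ) : ℂ) * Complex.I := by
    intro κ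
    push_cast
    ring
  obtain ⟨x, hx⟩ : (Set.Ioo rm rp).Nonempty := Set.nonempty_Ioo.2 h₁
  have hleft : Set.Ioo (rp - δ) rp ∩ Set.Ioo rm rp ∈ nhdsWithin rp (Set.Iio rp) :=
    Filter.inter_mem (Ioo_mem_nhdsLT (by linarith)) (Ioo_mem_nhdsLT h₁)
  have hright : Set.Ioo rm (rm + δ) ∩ Set.Ioo rm rp ∈ nhdsWithin rm (Set.Ioi rm) :=
    Filter.inter_mem (Ioo_mem_nhdsGT (by linarith)) (Ioo_mem_nhdsGT h₁)
  have hF₁ : radialFlux M e Λ R₁ x = -ω * rp ^ 2 := by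
    have hlim : Filter.Tendsto (radialFlux M e Λ R₁) (nhdsWithin rp (Set.Iio rp)) _ :=
      tendsto_radialFlux (σ := -1) (z := -(Complex.I * ω) / (2 * (kappaP M e Λ rp : ℂ)))
        (by rw [hexp, Complex.re_ofReal_mul, Complex.I_re, mul_zero]) h₀p.ne' hzp (uniqueDiffOn_Ioc _ _) (by simp [hδ]) hH₁ hH₁1
        (by
          refine le_inf nhdsWithin_le_nhds (Filter.le_principal_iff.2 ?_)
          filter_upwards [hleft] with r hr using ⟨hr.1.1, hr.1.2.le⟩)
        (by
          filter_upwards [hleft] with r hr using Ioc_mem_nhds hr.1.1 hr.1.2)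
        (by
          filter_upwards [hleft] with r hr
          linarith [hr.1.2])
        (by
          filter_upwards [hleft] with r hr
          filter_upwards [(isOpen_Ioo.inter isOpen_Ioo).mem_nhds hr] with s hs
          rw [hform₁ s hs, show -1 * (s - rp) = rp - s by ring])
    have hconst : Filter.Tendsto (radialFlux M e Λ R₁) (nhdsWithin rp (Set.Iio rp))
        (nhds (radialFlux M e Λ R₁ x)) := by
      refine tendsto_const_nhds.congr' ?_
      filter_upwards [hleft] with r hr using hR₁.radialFlux_eq h₀ hμ hx hr.2
    rw [tendsto_nhds_unique hconst hlim, hexp, Complex.im_ofReal_mul, Complex.I_im, kappaP]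
    field_simp
  have hF₂ : radialFlux M e Λ R₂ x = ω * rm ^ 2 := by
    have hlim : Filter.Tendsto (radialFlux M e Λ R₂) (nhdsWithin rm (Set.Ioi rm)) _ :=
      tendsto_radialFlux (σ := 1) (z := -(Complex.I * ω) / (2 * (kappaM M e Λ rm : ℂ)))
        (by rw [hexp, Complex.re_ofReal_mul, Complex.I_re, mul_zero]) h₀.ne' hzm (uniqueDiffOn_Ico _ _) (by simp [hδ]) hH₂ hH₂1
        (by
          refine le_inf nhdsWithin_le_nhds (Filter.le_principal_iff.2 ?_)
          filter_upwards [hright] with r hr using ⟨hr.1.1.le, hr.1.2⟩)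
        (by
          filter_upwards [hright] with r hr using Ico_mem_nhds hr.1.1 hr.1.2)
        (by
          filter_upwards [hright] with r hr
          linarith [hr.1.1])
        (by
          filter_upwards [hright] with r hr
          filter_upwards [(isOpen_Ioo.inter isOpen_Ioo).mem_nhds hr] with s hs
          rw [hform₂ s hs, one_mul])
    have hconst : Filter.Tendsto (radialFlux M e Λ R₂) (nhdsWithin rm (Set.Ioi rm))
        (nhds (radialFlux M e Λ R₂ x)) := by
      refine tendsto_const_nhds.congr' ?_
      filter_upwards [hright] with r hr using hR₂.radialFlux_eq h₀ hμ hx hr.2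
    rw [tendsto_nhds_unique hconst hlim, hexp, Complex.im_ofReal_mul, Complex.I_im, kappaM]
    field_simp
  have heq : (fun s => a * R₁ s) =ᶠ[nhds x] fun s => -b * R₂ s := by
    filter_upwards [isOpen_Ioo.mem_nhds hx] with s hs
    linear_combination hab s hs
  have hflux : radialFlux M e Λ (fun s => a * R₁ s) x =
      radialFlux M e Λ (fun s => -b * R₂ s) x := by
    simp only [radialFlux, heq.deriv_eq, heq.eq_of_nhds]
  rw [radialFlux_const_mul, radialFlux_const_mul, hF₁, hF₂, Complex.normSq_neg] at hflux
  have hsum : Complex.normSq a * rp ^ 2 + Complex.normSq b * rm ^ 2 = 0 := by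
    apply mul_left_cancel₀ hω
    linear_combination -hflux
  have ha := mul_nonneg (Complex.normSq_nonneg a) (sq_nonneg rp)
  have hb := mul_nonneg (Complex.normSq_nonneg b) (sq_nonneg rm)
  constructor
  · have : Complex.normSq a * rp ^ 2 = 0 := by linarith
    exact Complex.normSq_eq_zero.1 ((mul_eq_zero.1 this).resolve_right (by positivity))
  · have : Complex.normSq b * rm ^ 2 = 0 := by linarith
    exact Complex.normSq_eq_zero.1 ((mul_eq_zero.1 this).resolve_right (by positivity))
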